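/- Assume μ₊ > 0 and μ₋ > 0, and that one of the following holds: (c₊ > 0 and 0 < a ≤ min(a₁,a₂,a₃)), or (c₊ ≤ 0, Θ ≤ 0 and 0 < a ≤ a₁), or (c₊ ≤ 0, Θ > 0 and 0 < a ≤ min(a₁,a₃)). Then g is concave on (0,x₀) and convex on (x₀,∞). -/

import Mathlib

open Real Set Filter

/-- The function `b e^{p (x - a)} - c e^{-r (x - a)}`. -/
noncomputable def expDiff (p r a b c x : ℝ) : ℝ :=
  b * exp (p * (x - a)) - c * exp (-r * (x - a))

/-- The derivative of `expDiff`. -/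
noncomputable def expDiffDeriv (p r a b c x : ℝ) : ℝ :=
  b * p * exp (p * (x - a)) + c * r * exp (-r * (x - a))

lemma hasDerivAt_mul_exp_mul_sub (k p a x : ℝ) :
    HasDerivAt (fun x => k * exp (p * (x - a))) (k * p * exp (p * (x - a))) x := by
  have h : HasDerivAt (fun x => p * (x - a)) (p * 1) x :=
    ((hasDerivAt_id x).sub_const a).const_mul p
  exact (h.exp.const_mul k).congr_deriv (by ring)

lemma hasDerivAt_expDiff (p r a b c x : ℝ) :
    HasDerivAt (expDiff p r a b c) (expDiffDeriv p r a b c x) x := by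
  exact ((hasDerivAt_mul_exp_mul_sub b p a x).sub
    (hasDerivAt_mul_exp_mul_sub c (-r) a x)).congr_deriv (by unfold expDiffDeriv; ring)

lemma hasDerivAt_expDiffDeriv (p r a b c x : ℝ) :
    HasDerivAt (expDiffDeriv p r a b c)
      (b * p ^ 2 * exp (p * (x - a)) - c * r ^ 2 * exp (-r * (x - a))) x := by
  exact ((hasDerivAt_mul_exp_mul_sub (b * p) p a x).add
    (hasDerivAt_mul_exp_mul_sub (c * r) (-r) a x)).congr_deriv (by ring)

lemma antitoneOn_expDiffDeriv {p r a b c t : ℝ} (hp : 0 < p) (hr : 0 < r) (hb : 0 ≤ b)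
    (hc : 0 ≤ c)
    (h : b * p ^ 2 * exp (p * (t - a)) ≤ c * r ^ 2 * exp (-r * (t - a))) :
    AntitoneOn (expDiffDeriv p r a b c) (Iic t) := by
  refine antitoneOn_of_hasDerivWithinAt_nonpos (convex_Iic t)
    (fun x _ => (hasDerivAt_expDiffDeriv p r a b c x).continuousAt.continuousWithinAt)
    (fun x _ => (hasDerivAt_expDiffDeriv p r a b c x).hasDerivWithinAt) fun x hx => ?_
  have hxt : x ≤ t := mem_Iic.1 (interior_subset hx)
  have h₁ : b * p ^ 2 * exp (p * (x - a)) ≤ b * p ^ 2 * exp (p * (t - a)) := by gcongr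
  have h₂ : c * r ^ 2 * exp (-r * (t - a)) ≤ c * r ^ 2 * exp (-r * (x - a)) := by
    simp only [neg_mul]; gcongr
  linarith

lemma monotoneOn_expDiffDeriv {p r a b c t : ℝ} (hp : 0 < p) (hr : 0 < r) (hb : 0 ≤ b)
    (hc : 0 ≤ c)
    (h : c * r ^ 2 * exp (-r * (t - a)) ≤ b * p ^ 2 * exp (p * (t - a))) :
    MonotoneOn (expDiffDeriv p r a b c) (Ici t) := by
  refine monotoneOn_of_hasDerivWithinAt_nonneg (convex_Ici t)
    (fun x _ => (hasDerivAt_expDiffDeriv p r a b c x).continuousAt.continuousWithinAt)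
    (fun x _ => (hasDerivAt_expDiffDeriv p r a b c x).hasDerivWithinAt) fun x hx => ?_
  have hxt : t ≤ x := mem_Ici.1 (interior_subset hx)
  have h₁ : b * p ^ 2 * exp (p * (t - a)) ≤ b * p ^ 2 * exp (p * (x - a)) := by gcongr
  have h₂ : c * r ^ 2 * exp (-r * (x - a)) ≤ c * r ^ 2 * exp (-r * (t - a)) := by
    simp only [neg_mul]; gcongr
  linarith

/-- Two functions glued in a differentiable way at `a` form a differentiable function. -/
lemma hasDerivAt_of_glue {f u v u' v' : ℝ → ℝ} {a : ℝ} (hu : ∀ x, HasDerivAt u (u' x) x)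
    (hv : ∀ x, HasDerivAt v (v' x) x) (hfu : ∀ x ≤ a, f x = u x) (hfv : ∀ x, a ≤ x → f x = v x)
    (huv' : u' a = v' a) (x : ℝ) : HasDerivAt f (if x ≤ a then u' x else v' x) x := by
  rcases lt_trichotomy x a with hx | rfl | hx
  · rw [if_pos hx.le]
    refine (hu x).congr_of_eventuallyEq ?_
    filter_upwards [Iio_mem_nhds hx] with y hy using hfu y (le_of_lt hy)
  · rw [if_pos le_rfl]
    have hl : HasDerivWithinAt f (u' x) (Iic x) x :=
      (hu x).hasDerivWithinAt.congr (fun y hy => hfu y hy) (hfu x le_rfl)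
    have hr : HasDerivWithinAt f (u' x) (Ici x) x :=
      huv' ▸ (hv x).hasDerivWithinAt.congr (fun y hy => hfv y hy) (hfv x le_rfl)
    simpa only [Iic_union_Ici, hasDerivWithinAt_univ] using hl.union hr
  · rw [if_neg (not_le.2 hx)]
    refine (hv x).congr_of_eventuallyEq ?_
    filter_upwards [Ioi_mem_nhds hx] with y hy using hfv y (le_of_lt hy)

lemma concaveOn_of_glue {f u v u' v' : ℝ → ℝ} {a t : ℝ} (hat : a ≤ t)
    (hu : ∀ x, HasDerivAt u (u' x) x) (hv : ∀ x, HasDerivAt v (v' x) x)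
    (hfu : ∀ x ≤ a, f x = u x) (hfv : ∀ x, a ≤ x → f x = v x) (huv' : u' a = v' a)
    (hu' : AntitoneOn u' (Iic a)) (hv' : AntitoneOn v' (Icc a t)) :
    ConcaveOn ℝ (Iic t) f := by
  have hf := hasDerivAt_of_glue hu hv hfu hfv huv'
  refine AntitoneOn.concaveOn_of_deriv (convex_Iic t)
    (fun x _ => (hf x).continuousAt.continuousWithinAt)
    (fun x _ => (hf x).differentiableAt.differentiableWithinAt) ?_
  intro x hx y hy hxy
  have hyt : y ≤ t := mem_Iic.1 (interior_subset hy)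
  rw [(hf x).deriv, (hf y).deriv]
  by_cases hya : y ≤ a
  · rw [if_pos hya, if_pos (hxy.trans hya)]
    exact hu' (hxy.trans hya) hya hxy
  · rw [if_neg hya]
    have hay := (not_le.1 hya).le
    split_ifs with hxa
    · calc v' y ≤ v' a := hv' ⟨le_rfl, hat⟩ ⟨hay, hyt⟩ hay
        _ = u' a := huv'.symm
        _ ≤ u' x := hu' hxa (le_refl a) hxa
    · exact hv' ⟨(not_le.1 hxa).le, hxy.trans hyt⟩ ⟨hay, hyt⟩ hxy

lemma convexOn_Ici_expDiff {p r a b c t : ℝ} (hp : 0 < p) (hr : 0 < r) (hb : 0 ≤ b)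
    (hc : 0 ≤ c)
    (h : c * r ^ 2 * exp (-r * (t - a)) ≤ b * p ^ 2 * exp (p * (t - a))) :
    ConvexOn ℝ (Ici t) (expDiff p r a b c) := by
  refine MonotoneOn.convexOn_of_deriv (convex_Ici t)
    (fun x _ => (hasDerivAt_expDiff p r a b c x).continuousAt.continuousWithinAt)
    (fun x _ => (hasDerivAt_expDiff p r a b c x).differentiableAt.differentiableWithinAt) ?_
  rw [funext fun x => (hasDerivAt_expDiff p r a b c x).deriv]
  exact (monotoneOn_expDiffDeriv hp hr hb hc h).mono interior_subset

/-- For positive drift the two roots are ordered and positive. -/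
lemma sqrt_sub_div_pos_and_lt {μ q σ : ℝ} (hμ : 0 < μ) (hq : 0 < q) (hσ : 0 < σ) :
    0 < (√(μ ^ 2 + 2 * q * σ ^ 2) - μ) / σ ^ 2 ∧
      (√(μ ^ 2 + 2 * q * σ ^ 2) - μ) / σ ^ 2 < (√(μ ^ 2 + 2 * q * σ ^ 2) + μ) / σ ^ 2 := by
  have h : μ < √(μ ^ 2 + 2 * q * σ ^ 2) := lt_sqrt_of_sq_lt (by nlinarith [mul_pos hq (pow_pos hσ 2)])
  exact ⟨div_pos (by linarith) (by positivity), by gcongr; linarith⟩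

lemma exp_mul_le_of_le_log_div {s a R : ℝ} (hs : 0 < s) (hR : 0 < R) (h : a ≤ log R / s) :
    exp (s * a) ≤ R := by
  rw [le_div_iff₀ hs] at h
  rw [← le_log_iff_exp_le hR]
  linarith

theorem statement4
    (a q μp μm σp σm : ℝ)
    (ha : 0 < a) (hq : 0 < q) (hσp : 0 < σp) (hσm : 0 < σm)
    (θ1p θ2p θ1m θ2m cm cp : ℝ)
    (hθ1p : θ1p = (Real.sqrt (μp ^ 2 + 2 * q * σp ^ 2) + μp) / σp ^ 2)
    (hθ2p : θ2p = (Real.sqrt (μp ^ 2 + 2 * q * σp ^ 2) - μp) / σp ^ 2)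
    (hθ1m : θ1m = (Real.sqrt (μm ^ 2 + 2 * q * σm ^ 2) + μm) / σm ^ 2)
    (hθ2m : θ2m = (Real.sqrt (μm ^ 2 + 2 * q * σm ^ 2) - μm) / σm ^ 2)
    (hcm : cm = (θ1m - θ1p) / (θ2m + θ1m))
    (hcp : cp = (θ2p - θ2m) / (θ2p + θ1p))
    (gm gp g : ℝ → ℝ)
    (hgm : ∀ x, gm x = if a < x then Real.exp (-θ1p * (x - a))
      else cm * Real.exp (θ2m * (x - a)) + (1 - cm) * Real.exp (-θ1m * (x - a)))
    (hgp : ∀ x, gp x = if a < x then (1 - cp) * Real.exp (θ2p * (x - a)) + cp * Real.exp (-θ1p * (x - a))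
      else Real.exp (θ2m * (x - a)))
    (hg : ∀ x, g x = gp x * gm 0 - gm x * gp 0)
    (hμp : 0 < μp) (hμm : 0 < μm)
    (Θ : ℝ)
    (hΘ : Θ = cp * θ1p ^ 2 + (1 - cp) * θ2p ^ 2)
    (x₀ : ℝ)
    (hx₀ : x₀ = a + Real.log ((gp 0 - cp * gm 0) * θ1p ^ 2 / ((1 - cp) * gm 0 * θ2p ^ 2)) / (θ2p + θ1p))
    (a₁ : ℝ)
    (ha₁ : a₁ = 2 * Real.log (θ1m / θ2m) / (θ2m + θ1m))
    (a₂ : ℝ)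
    (ha₂ : a₂ = Real.log ((θ2p + θ1m) / (θ2p - θ2m)) / (θ1m + θ2m))
    (a₃ : ℝ)
    (ha₃ : a₃ = Real.log (((1 - cm * cp) * θ1p ^ 2 - (1 - cp) * cm * θ2p ^ 2) / ((1 - cm) * Θ)) / (θ1m + θ2m))
    (hcase : (0 < cp ∧ 0 < a ∧ a ≤ min a₁ (min a₂ a₃)) ∨
      (cp ≤ 0 ∧ Θ ≤ 0 ∧ 0 < a ∧ a ≤ a₁) ∨
      (cp ≤ 0 ∧ 0 < Θ ∧ 0 < a ∧ a ≤ min a₁ a₃))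
    :
    ConcaveOn ℝ (Set.Ioo 0 x₀) g ∧ ConvexOn ℝ (Set.Ioi x₀) g := by
  obtain ⟨hp2, hp21⟩ := sqrt_sub_div_pos_and_lt hμp hq hσp
  obtain ⟨hm2, hm21⟩ := sqrt_sub_div_pos_and_lt hμm hq hσm
  rw [← hθ2p] at hp2
  rw [← hθ2p, ← hθ1p] at hp21
  rw [← hθ2m] at hm2
  rw [← hθ2m, ← hθ1m] at hm21
  clear hθ1p hθ2p hθ1m hθ2m
  have hp1 : 0 < θ1p := hp2.trans hp21
  have hm1 : 0 < θ1m := hm2.trans hm21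
  have hsp : 0 < θ2p + θ1p := by positivity
  have hsm : 0 < θ2m + θ1m := by positivity
  have hcm' : cm * (θ2m + θ1m) = θ1m - θ1p := by rw [hcm]; field_simp
  have hcp' : cp * (θ2p + θ1p) = θ2p - θ2m := by rw [hcp]; field_simp
  have hcm1 : 0 < 1 - cm := (mul_pos_iff_of_pos_right hsm).1 (by linarith)
  have hcp1 : 0 < 1 - cp := (mul_pos_iff_of_pos_right hsp).1 (by linarith)
  have hgp0 : gp 0 = exp (-(θ2m * a)) := by
    rw [hgp, if_neg ha.not_gt]; congr 1; ring
  have hgm0 : gm 0 = cm * exp (-(θ2m * a)) + (1 - cm) * exp (θ1m * a) := by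
    rw [hgm, if_neg ha.not_gt]; congr 3 <;> ring
  have hE : exp (θ1m * a) = exp ((θ1m + θ2m) * a) * exp (-(θ2m * a)) := by
    rw [← exp_add]; congr 1; ring
  have hgp0pos : 0 < gp 0 := hgp0 ▸ exp_pos _
  have hgm0pos : 0 < gm 0 := by
    have h : exp (-(θ2m * a)) < exp (θ1m * a) := exp_lt_exp.2 (by linarith [mul_pos hm1 ha, mul_pos hm2 ha])
    rw [hgm0]
    linarith [exp_pos (-(θ2m * a)), mul_pos hcm1 (sub_pos.2 h)]
  have haa₁ : a ≤ a₁ := by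
    rcases hcase with ⟨-, -, h⟩ | ⟨-, -, -, h⟩ | ⟨-, -, -, h⟩
    · exact h.trans (min_le_left _ _)
    · exact h
    · exact h.trans (min_le_left _ _)
  have haa₃ : 0 < Θ → a ≤ a₃ := fun hpos => by
    rcases hcase with ⟨-, -, h⟩ | ⟨-, hn, -, -⟩ | ⟨-, -, -, h⟩
    · exact h.trans ((min_le_right _ _).trans (min_le_right _ _))
    · exact absurd hpos hn.not_gt
    · exact h.trans (min_le_right _ _)
  have hleft : (gm 0 - cm * gp 0) * θ2m ^ 2 ≤ (gp 0 * (1 - cm)) * θ1m ^ 2 := by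
    have h : exp ((θ1m + θ2m) * a) ≤ (θ1m / θ2m) ^ 2 := by
      refine exp_mul_le_of_le_log_div (by positivity) (by positivity) ?_
      rw [log_pow, add_comm θ1m]
      exact_mod_cast ha₁ ▸ haa₁
    rw [div_pow, le_div_iff₀ (by positivity)] at h
    have := mul_le_mul_of_nonneg_left h (mul_pos hgp0pos hcm1).le
    rw [hgp0] at this ⊢
    rw [hgm0, hE]
    linarith
  have hright : gm 0 * Θ ≤ gp 0 * θ1p ^ 2 := by
    rcases le_or_gt Θ 0 with hn | hpos
    · exact (mul_nonpos_of_nonneg_of_nonpos hgm0pos.le hn).trans (by positivity)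
    · have hΘle : Θ ≤ θ1p ^ 2 := by
        have : θ2p ^ 2 ≤ θ1p ^ 2 := by gcongr
        rw [hΘ]
        linarith [mul_le_mul_of_nonneg_left this hcp1.le]
      have hnum : (1 - cm * cp) * θ1p ^ 2 - (1 - cp) * cm * θ2p ^ 2 = θ1p ^ 2 - cm * Θ := by
        rw [hΘ]; ring
      have h := haa₃ hpos
      rw [ha₃, hnum] at h
      have hcmΘ : 0 < (1 - cm) * Θ := mul_pos hcm1 hpos
      have h := exp_mul_le_of_le_log_div (add_pos hm1 hm2) (div_pos (by linarith) hcmΘ) h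
      rw [le_div_iff₀ hcmΘ] at h
      have := mul_le_mul_of_nonneg_left h hgp0pos.le
      rw [hgp0] at this ⊢
      rw [hgm0, hE]
      linarith
  have hb : 0 < (1 - cp) * gm 0 := by positivity
  have hratio : (1 - cp) * gm 0 * θ2p ^ 2 ≤ (gp 0 - cp * gm 0) * θ1p ^ 2 := by
    rw [hΘ] at hright; linarith
  have hc : 0 < gp 0 - cp * gm 0 := by
    have : 0 < (gp 0 - cp * gm 0) * θ1p ^ 2 := lt_of_lt_of_le (by positivity) hratio
    exact (mul_pos_iff_of_pos_right (by positivity)).1 this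
  set R := (gp 0 - cp * gm 0) * θ1p ^ 2 / ((1 - cp) * gm 0 * θ2p ^ 2) with hR
  have hR1 : 1 ≤ R := (one_le_div (by positivity)).2 hratio
  have hax₀ : a ≤ x₀ := by
    rw [hx₀]
    have : 0 ≤ log R / (θ2p + θ1p) := div_nonneg (log_nonneg hR1) hsp.le
    linarith
  have hx₀eq : (1 - cp) * gm 0 * θ2p ^ 2 * exp (θ2p * (x₀ - a)) =
      (gp 0 - cp * gm 0) * θ1p ^ 2 * exp (-θ1p * (x₀ - a)) := by
    have h₁ : θ2p * (x₀ - a) = log R + -θ1p * (x₀ - a) := by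
      rw [hx₀]; field_simp; ring
    rw [h₁, exp_add, exp_log (by linarith), hR]
    field_simp
  have hgl : ∀ x ≤ a, g x = expDiff θ2m θ1m a (gm 0 - cm * gp 0) (gp 0 * (1 - cm)) x := by
    intro x hx
    rw [hg, hgp x, hgm x, if_neg hx.not_gt, if_neg hx.not_gt, expDiff]
    ring
  have hgr : ∀ x, a ≤ x → g x = expDiff θ2p θ1p a ((1 - cp) * gm 0) (gp 0 - cp * gm 0) x := by
    intro x hx
    rcases hx.eq_or_lt with rfl | hx
    · rw [hgl a le_rfl, expDiff, expDiff]
      simp only [sub_self, mul_zero, exp_zero]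
      ring
    · rw [hg, hgp x, hgm x, if_pos hx, if_pos hx, expDiff]
      ring
  constructor
  · refine (concaveOn_of_glue hax₀ (hasDerivAt_expDiff _ _ _ _ _) (hasDerivAt_expDiff _ _ _ _ _)
      hgl hgr ?_ ?_ ?_).subset (fun x hx => hx.2.le) (convex_Ioo 0 x₀)
    · simp only [expDiffDeriv, sub_self, mul_zero, exp_zero, mul_one]
      linear_combination gm 0 * hcp' - gp 0 * hcm'
    · refine antitoneOn_expDiffDeriv hm2 hm1 ?_ (by positivity) ?_
      · rw [hgm0, hgp0]
        have := mul_pos hcm1 (exp_pos (θ1m * a))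
        linarith
      · simpa only [sub_self, mul_zero, exp_zero, mul_one] using hleft
    · exact (antitoneOn_expDiffDeriv hp2 hp1 hb.le hc.le hx₀eq.le).mono Icc_subset_Iic_self
  · refine ((convexOn_Ici_expDiff hp2 hp1 hb.le hc.le hx₀eq.ge).subset Ioi_subset_Ici_self
      (convex_Ioi x₀)).congr fun x hx => (hgr x (hax₀.trans (le_of_lt hx))).symm
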